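/- arXiv:2405.16562 — 2 statements merged into one kernel-verified Lean document; each statement's English description precedes it below -/
import Mathlib

section
/- (Remark 2.6, on the compact embedding condition B ≪ G*.) Let 0 < s < 1, N ≥ 1 an integer, and let G(t) = ∫₀^t g(τ) dτ be an N-function (g positive for t > 0, right-continuous, non-decreasing, g(0) = 0, g(t) → ∞) satisfying q⁻ ≤ t g(t)/G(t) for all t > 0 with 1 < q⁻ and s q⁻ < N. Assume ∫₀¹ G⁻¹(t)/t^{(N+s)/N} dt < ∞ and ∫₁^∞ G⁻¹(t)/t^{(N+s)/N} dt = ∞, and define the Sobolev conjugate G* by (G*)⁻¹(t) = ∫₀^t G⁻¹(w)/w^{(N+s)/N} dw, where G⁻¹ is the inverse of G on [0, ∞). If p + 1 < N q⁻/(N − s q⁻), then for every k > 0, lim_{t → ∞} (k t)^{p+1} / G*(t) = 0; that is, B(t) = t^{p+1} is essentially weaker than G* (B ≪ G*). -/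
open Set Filter MeasureTheory

/-- If `g` is monotone and right-continuous on `[0, ∞)`, its primitive `G` has right
derivative `g`. -/
theorem hasDerivWithinAt_Ici_primitive_of_monotoneOn {g G : ℝ → ℝ}
    (hgmono : MonotoneOn g (Ici 0))
    (hgrc : ∀ t ∈ Ici (0:ℝ), ContinuousWithinAt g (Ici t) t)
    (hG : ∀ t : ℝ, G t = ∫ τ in (0:ℝ)..t, g τ) {t : ℝ} (ht : 0 ≤ t) :
    HasDerivWithinAt G (g t) (Ici t) t := by
  obtain rfl : G = fun u => ∫ τ in (0:ℝ)..u, g τ := funext hG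
  have hint : IntervalIntegrable g volume 0 t := by
    apply MonotoneOn.intervalIntegrable
    apply hgmono.mono
    rw [uIcc_of_le ht]
    exact Icc_subset_Ici_self
  refine intervalIntegral.integral_hasDerivWithinAt_right hint (t := Ioi t) ?_
    ((hgrc t ht).mono Ioi_subset_Ici_self)
  refine ⟨Ioi t, self_mem_nhdsWithin, ?_⟩
  exact (aemeasurable_restrict_of_monotoneOn measurableSet_Ioi
    (hgmono.mono fun x hx => ht.trans (le_of_lt hx))).aestronglyMeasurable

/-- A primitive of a function monotone on `[0, ∞)` is continuous on `[0, ∞)`. -/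
theorem continuousOn_Icc_primitive_of_monotoneOn {g G : ℝ → ℝ}
    (hgmono : MonotoneOn g (Ici 0))
    (hG : ∀ t : ℝ, G t = ∫ τ in (0:ℝ)..t, g τ) {b : ℝ} (hb : 0 ≤ b) :
    ContinuousOn G (Icc 0 b) := by
  obtain rfl : G = fun u => ∫ τ in (0:ℝ)..u, g τ := funext hG
  rw [← uIcc_of_le hb]
  apply intervalIntegral.continuousOn_primitive_interval
  rw [uIcc_of_le hb]
  exact (hgmono.mono Icc_subset_Ici_self).integrableOn_isCompact isCompact_Icc

/-- If `q G(t) ≤ t g(t)`, then `G` grows at least like the power `t ^ q`. -/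
theorem mul_rpow_le_primitive {g G : ℝ → ℝ} {q : ℝ}
    (hgmono : MonotoneOn g (Ici 0))
    (hgrc : ∀ t ∈ Ici (0:ℝ), ContinuousWithinAt g (Ici t) t)
    (hG : ∀ t : ℝ, G t = ∫ τ in (0:ℝ)..t, g τ)
    (hq : ∀ t : ℝ, 0 < t → q * G t ≤ t * g t) {t : ℝ} (ht : 1 ≤ t) :
    G 1 * t ^ q ≤ G t := by
  have key : G 1 ≤ G t * t ^ (-q) := by
    refine image_le_of_deriv_right_le_deriv_boundary (f := fun _ => G 1) (f' := fun _ => 0)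
      (a := 1) (b := t) (B := fun x => G x * x ^ (-q))
      (B' := fun x => g x * x ^ (-q) + G x * (-q * x ^ (-q - 1)))
      continuousOn_const (fun x _ => hasDerivWithinAt_const _ _ _) (by simp) ?_ ?_ ?_
      (right_mem_Icc.2 ht)
    · refine ((continuousOn_Icc_primitive_of_monotoneOn hgmono hG
        (zero_le_one.trans ht)).mono (Icc_subset_Icc_left zero_le_one)).mul ?_
      exact fun x hx => (Real.continuousAt_rpow_const x _
        (Or.inl (zero_lt_one.trans_le hx.1).ne')).continuousWithinAt
    · intro x hx
      have hx0 : 0 < x := zero_lt_one.trans_le hx.1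
      exact (hasDerivWithinAt_Ici_primitive_of_monotoneOn hgmono hgrc hG hx0.le).mul
        (Real.hasDerivAt_rpow_const (Or.inl hx0.ne')).hasDerivWithinAt
    · intro x hx
      have hx0 : 0 < x := zero_lt_one.trans_le hx.1
      have e : x ^ (-q) = x * x ^ (-q - 1) := by
        rw [Real.rpow_sub_one hx0.ne']
        field_simp
      have := mul_nonneg (sub_nonneg.2 (hq x hx0)) (Real.rpow_nonneg hx0.le (-q - 1))
      rw [e]
      linarith
  have ht0 : 0 < t := zero_lt_one.trans_le ht
  rwa [Real.rpow_neg ht0.le, ← div_eq_mul_inv, le_div_iff₀ (Real.rpow_pos_of_pos ht0 q)] at key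

/-- A right inverse of a function growing at least like `c * t ^ q` grows at most like
`w ^ (1 / q)`. -/
theorem rightInverse_le_mul_rpow {G Ginv : ℝ → ℝ} {c q : ℝ} (hc : 0 < c) (hq : 0 < q)
    (hG : ∀ t : ℝ, 1 ≤ t → c * t ^ q ≤ G t)
    (hGinv : ∀ t : ℝ, 0 ≤ t → G (Ginv t) = t) {w : ℝ} (hw : 1 ≤ w) :
    Ginv w ≤ (1 + (1 / c) ^ (1 / q)) * w ^ (1 / q) := by
  have hw0 : 0 ≤ w := zero_le_one.trans hw
  have h1 : 1 ≤ w ^ (1 / q) := Real.one_le_rpow hw (by positivity)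
  have h2 : 0 ≤ (1 / c) ^ (1 / q) := by positivity
  rcases le_total (Ginv w) 1 with h | h
  · nlinarith
  · have h3 : Ginv w ^ q ≤ 1 / c * w := by
      have := hG _ h
      rw [hGinv w hw0] at this
      rw [one_div_mul_eq_div, le_div_iff₀ hc]
      linarith
    have h4 : Ginv w ≤ (1 / c * w) ^ (1 / q) := by
      rw [one_div q]
      exact (Real.le_rpow_inv_iff_of_pos (zero_le_one.trans h) (by positivity) hq).2 h3
    rw [Real.mul_rpow (by positivity) hw0] at h4
    linarith

/-- If `f w ≤ C * w ^ (a - 1)` for `w ≥ 1`, then `∫₀^T f` is at most a multiple of `T ^ a`. -/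
theorem integral_le_mul_rpow {f : ℝ → ℝ} {C a T : ℝ} (hC : 0 ≤ C) (ha : 0 < a) (hT : 1 ≤ T)
    (hf : ∀ w : ℝ, 1 ≤ w → f w ≤ C * w ^ (a - 1))
    (hf0 : 0 ≤ ∫ w in (0:ℝ)..1, f w)
    (hint : IntervalIntegrable f volume 0 T) :
    ∫ w in (0:ℝ)..T, f w ≤ ((∫ w in (0:ℝ)..1, f w) + C / a) * T ^ a := by
  have hT0 : 0 ≤ T := zero_le_one.trans hT
  have i1 : IntervalIntegrable f volume 0 1 := hint.mono_set (by
    rw [uIcc_of_le zero_le_one, uIcc_of_le hT0]; exact Icc_subset_Icc_right hT)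
  have i2 : IntervalIntegrable f volume 1 T := hint.mono_set (by
    rw [uIcc_of_le hT, uIcc_of_le hT0]; exact Icc_subset_Icc_left zero_le_one)
  have h2 : ∫ w in (1:ℝ)..T, f w ≤ ∫ w in (1:ℝ)..T, C * w ^ (a - 1) :=
    intervalIntegral.integral_mono_on hT i2
      ((intervalIntegral.intervalIntegrable_rpow' (by linarith)).const_mul C)
      fun w hw => hf w hw.1
  rw [intervalIntegral.integral_const_mul, integral_rpow (Or.inl (by linarith)),
    sub_add_cancel, Real.one_rpow] at h2
  rw [← intervalIntegral.integral_add_adjacent_intervals i1 i2]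
  have hTa : 1 ≤ T ^ a := Real.one_le_rpow hT ha.le
  have h3 : C * ((T ^ a - 1) / a) = C / a * T ^ a - C / a := by ring
  have h4 : 0 ≤ C / a := by positivity
  nlinarith

/-- If `t ≤ D * f t ^ a` eventually and `r < 1 / a`, then `t ^ r` is negligible against `f`, after
any rescaling of the variable. -/
theorem tendsto_rpow_div_of_le_mul_rpow {f : ℝ → ℝ} {D a r k : ℝ} (hD : 0 < D) (ha : 0 < a)
    (hr : r < 1 / a) (hk : 0 < k) (hf0 : ∀ᶠ t in atTop, 0 < f t)
    (hf : ∀ᶠ t in atTop, t ≤ D * f t ^ a) :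
    Tendsto (fun t : ℝ => (k * t) ^ r / f t) atTop (nhds 0) := by
  have hlim : Tendsto (fun t : ℝ => k ^ r * D ^ (1 / a) * t ^ (-(1 / a - r))) atTop (nhds 0) := by
    simpa using (tendsto_rpow_neg_atTop (sub_pos.2 hr)).const_mul (k ^ r * D ^ (1 / a))
  refine squeeze_zero' ?_ ?_ hlim
  · filter_upwards [hf0, eventually_gt_atTop 0] with t h1 h2
    positivity
  · filter_upwards [hf0, hf, eventually_gt_atTop 0] with t h1 h2 ht
    have h3 : (t / D) ^ (1 / a) ≤ f t := by
      rw [one_div, Real.rpow_inv_le_iff_of_pos (by positivity) h1.le ha, div_le_iff₀ hD]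
      linarith
    calc (k * t) ^ r / f t ≤ (k * t) ^ r / (t / D) ^ (1 / a) := by gcongr
      _ = k ^ r * D ^ (1 / a) * t ^ (-(1 / a - r)) := by
        rw [Real.mul_rpow hk.le ht.le, Real.div_rpow ht.le hD.le, neg_sub, Real.rpow_sub ht]
        field_simp

/-- Remark 2.6: under (H₂), with `G*` the Sobolev conjugate of `G` defined by
`(G*)⁻¹(t) = ∫₀^t G⁻¹(w)/w^{(N+s)/N} dw`, if `p + 1 < N q⁻/(N − s q⁻)` then
`B(t) = t^{p+1}` is essentially weaker than `G*`: for every `k > 0`,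
`(k t)^{p+1} / G*(t) → 0` as `t → ∞`. -/
theorem power_essentially_weaker_than_sobolev_conjugate
    (N : ℕ) (hN : 1 ≤ N) (s : ℝ) (hs0 : 0 < s) (hs1 : s < 1)
    (g G : ℝ → ℝ)
    (hgpos : ∀ t : ℝ, 0 < t → 0 < g t)
    (hg0 : g 0 = 0)
    (hgmono : MonotoneOn g (Ici 0))
    (hgrc : ∀ t ∈ Ici (0:ℝ), ContinuousWithinAt g (Ici t) t)
    (hgtop : Tendsto g atTop atTop)
    (hG : ∀ t : ℝ, G t = ∫ τ in (0:ℝ)..t, g τ)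
    (qm : ℝ) (hqm : 1 < qm)
    (hq : ∀ t : ℝ, 0 < t → qm ≤ t * g t / G t)
    (hsqm : s * qm < N)
    (Ginv : ℝ → ℝ)
    (hGinv : ∀ t : ℝ, 0 ≤ t → 0 ≤ Ginv t ∧ G (Ginv t) = t)
    (hGinv' : ∀ t : ℝ, 0 ≤ t → Ginv (G t) = t)
    (hint1 : IntegrableOn (fun w => Ginv w / w ^ (((N : ℝ) + s) / N)) (Ioc (0:ℝ) 1)
      (volume : Measure ℝ))
    (hint2 : ∫⁻ w in Ioi (1:ℝ), ENNReal.ofReal (Ginv w / w ^ (((N : ℝ) + s) / N)) = ⊤)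
    (Gstar : ℝ → ℝ)
    (hGstar0 : ∀ t : ℝ, 0 ≤ t → 0 ≤ Gstar t)
    (hGstarMono : StrictMonoOn Gstar (Ici 0))
    (hGstarInv : ∀ t : ℝ, 0 ≤ t →
      (∫ w in (0:ℝ)..(Gstar t), Ginv w / w ^ (((N : ℝ) + s) / N)) = t)
    (hGstarInv' : ∀ t : ℝ, 0 ≤ t →
      Gstar (∫ w in (0:ℝ)..t, Ginv w / w ^ (((N : ℝ) + s) / N)) = t)
    (p : ℝ) (hp : p + 1 < N * qm / ((N : ℝ) - s * qm)) :
    ∀ k : ℝ, 0 < k →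
      Tendsto (fun t : ℝ => (k * t) ^ (p + 1) / Gstar t) atTop (nhds 0) := by
  intro k hk
  have hN0 : (0:ℝ) < N := by exact_mod_cast hN
  have hq0 : 0 < qm := by linarith
  have hGpos : ∀ t : ℝ, 0 < t → 0 < G t := by
    intro t ht
    by_contra! h
    have := div_nonpos_of_nonneg_of_nonpos (mul_pos ht (hgpos t ht)).le h
    linarith [hq t ht]
  have hgrow : ∀ t : ℝ, 1 ≤ t → G 1 * t ^ qm ≤ G t := fun t ht =>
    mul_rpow_le_primitive hgmono hgrc hG
      (fun x hx => (le_div_iff₀ (hGpos x hx)).1 (hq x hx)) ht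
  have hG1 := hGpos 1 one_pos
  set f : ℝ → ℝ := fun w => Ginv w / w ^ (((N : ℝ) + s) / N) with hf
  set C : ℝ := 1 + (1 / G 1) ^ (1 / qm) with hC
  have hC0 : 0 < C := by positivity
  set a : ℝ := 1 / qm - s / N with ha
  have haeq : a = ((N : ℝ) - s * qm) / (N * qm) := by
    rw [ha]
    field_simp
  have ha0 : 0 < a := by
    rw [haeq]
    exact div_pos (by linarith) (by positivity)
  have hfle : ∀ w : ℝ, 1 ≤ w → f w ≤ C * w ^ (a - 1) := by
    intro w hw
    have hw0 : 0 < w := by linarith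
    have e : a - 1 = 1 / qm - ((N : ℝ) + s) / N := by
      rw [ha]
      field_simp
      ring
    rw [e, Real.rpow_sub hw0, ← mul_div_assoc]
    exact div_le_div_of_nonneg_right
      (rightInverse_le_mul_rpow hG1 hq0 hgrow (fun t ht => (hGinv t ht).2) hw)
      (Real.rpow_nonneg hw0.le _)
  have hF1 : 0 ≤ ∫ w in (0:ℝ)..1, f w :=
    intervalIntegral.integral_nonneg zero_le_one fun w hw =>
      div_nonneg (hGinv w hw.1).1 (Real.rpow_nonneg hw.1 _)
  have hone : ∀ t : ℝ, (∫ w in (0:ℝ)..1, f w) ≤ t → 1 ≤ Gstar t := by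
    intro t ht
    rw [← hGstarInv' 1 zero_le_one]
    exact hGstarMono.monotoneOn hF1 (hF1.trans ht) ht
  refine tendsto_rpow_div_of_le_mul_rpow
    (D := (∫ w in (0:ℝ)..1, f w) + C / a) (a := a) (by positivity) ha0 ?_ hk ?_ ?_
  · rwa [haeq, one_div_div]
  · filter_upwards [eventually_ge_atTop (∫ w in (0:ℝ)..1, f w)] with t ht
    exact zero_lt_one.trans_le (hone t ht)
  · filter_upwards [eventually_ge_atTop (∫ w in (0:ℝ)..1, f w), eventually_gt_atTop 0]
      with t ht ht0
    have hint : IntervalIntegrable f volume 0 (Gstar t) := by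
      by_contra h
      have := hGstarInv t ht0.le
      rw [intervalIntegral.integral_undef h] at this
      exact ht0.ne this
    have := integral_le_mul_rpow hC0.le ha0 (hone t ht) hfle hF1 hint
    rwa [hGstarInv t ht0.le] at this
end

section
/- (Concavity blow-up lemma underlying the proof of Theorem 2.5.) Let ϑ > 0 and b > 0, and let F : [0, b] → ℝ be twice differentiable with F(t) > 0 for every t ∈ [0, b], F'(0) > 0, and F''(t) F(t) ≥ (1 + ϑ) (F'(t))² for every t ∈ [0, b]. Then b < F(0) / (ϑ F'(0)). -/
open Set

/-- Concavity blow-up lemma underlying the proof of Theorem 2.5 (blowup): if `F > 0` on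
`[0, b]`, `F'(0) > 0` and `F'' F ≥ (1 + ϑ)(F')²` on `[0, b]` with `ϑ > 0`, then
`b < F(0)/(ϑ F'(0))`. -/
theorem concavity_blowup (ϑ b : ℝ) (hϑ : 0 < ϑ) (hb : 0 < b)
    (F F' F'' : ℝ → ℝ)
    (hd1 : ∀ t ∈ Icc (0:ℝ) b, HasDerivAt F (F' t) t)
    (hd2 : ∀ t ∈ Icc (0:ℝ) b, HasDerivAt F' (F'' t) t)
    (hFpos : ∀ t ∈ Icc (0:ℝ) b, 0 < F t)
    (hF'0 : 0 < F' 0)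
    (hconc : ∀ t ∈ Icc (0:ℝ) b, (1 + ϑ) * (F' t) ^ 2 ≤ F'' t * F t) :
    b < F 0 / (ϑ * F' 0) := by
  have h0 : (0:ℝ) ∈ Icc (0:ℝ) b := left_mem_Icc.2 hb.le
  have hbm : b ∈ Icc (0:ℝ) b := right_mem_Icc.2 hb.le
  have hF''nonneg : ∀ t ∈ Icc (0:ℝ) b, 0 ≤ F'' t := fun t ht =>
    nonneg_of_mul_nonneg_left ((by positivity : 0 ≤ (1 + ϑ) * F' t ^ 2).trans (hconc t ht))
      (hFpos t ht)
  have hmono : MonotoneOn F' (Icc 0 b) :=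
    monotoneOn_of_hasDerivWithinAt_nonneg (convex_Icc 0 b)
      (fun t ht => (hd2 t ht).continuousAt.continuousWithinAt)
      (fun t ht => (hd2 t (interior_subset ht)).hasDerivWithinAt)
      (fun t ht => hF''nonneg t (interior_subset ht))
  have hF'pos : ∀ t ∈ Icc (0:ℝ) b, 0 < F' t := fun t ht =>
    hF'0.trans_le (hmono h0 ht ht.1)
  -- The quotient `F / F'` decreases at rate at least `ϑ` and stays positive.
  have hd : ∀ t ∈ Icc (0:ℝ) b, HasDerivAt (fun t => F t / F' t + ϑ * t)
      ((F' t * F' t - F t * F'' t) / F' t ^ 2 + ϑ * 1) t := fun t ht =>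
    ((hd1 t ht).div (hd2 t ht) (hF'pos t ht).ne').add ((hasDerivAt_id t).const_mul ϑ)
  have hanti : AntitoneOn (fun t => F t / F' t + ϑ * t) (Icc 0 b) := by
    refine antitoneOn_of_hasDerivWithinAt_nonpos (convex_Icc 0 b)
      (fun t ht => (hd t ht).continuousAt.continuousWithinAt)
      (fun t ht => (hd t (interior_subset ht)).hasDerivWithinAt) (fun t ht => ?_)
    have ht := interior_subset ht
    have hle : (F' t * F' t - F t * F'' t) / F' t ^ 2 ≤ -ϑ := by
      rw [div_le_iff₀ (pow_pos (hF'pos t ht) 2)]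
      linarith [hconc t ht]
    linarith
  have hle : F b / F' b + ϑ * b ≤ F 0 / F' 0 + ϑ * 0 := hanti h0 hbm hb.le
  have hpos : 0 < F b / F' b := div_pos (hFpos b hbm) (hF'pos b hbm)
  rw [mul_comm, ← div_div, lt_div_iff₀ hϑ]
  linarith
end
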